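/- Let A, B_1, …, B_M be symmetric real N×N matrices, D := { x ∈ ℝ^N : xᵀB_ix ≤ 1 for all i }, and let P be an invertible real N×N matrix with PᵀAP = A and PᵀB_iP = B_{σ(i)} for all i, for some permutation σ of {1,…,M}. Let a ∈ ℝ^N and suppose that for every x ∈ ℝ^N with aᵀx ≤ 0 one has aᵀ(Px) ≥ 0. Then the supremum of xᵀAx over D equals the supremum of xᵀAx over D ∩ { x : aᵀx ≥ 0 }. -/

import Mathlib

open Matrix

/-- The quadratic form of `C` at `P x` is the quadratic form of `Pᵀ C P` at `x`. -/
theorem mulVec_dotProduct_mulVec_mulVec {m n R : Type*} [Fintype m] [Fintype n] [CommSemiring R]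
    (P : Matrix m n R) (C : Matrix m m R) (x : n → R) :
    P.mulVec x ⬝ᵥ C.mulVec (P.mulVec x) = x ⬝ᵥ (Pᵀ * C * P).mulVec x := by
  rw [← mulVec_mulVec, ← mulVec_mulVec, dotProduct_mulVec x, vecMul_transpose]

/-- If `P` is a linear symmetry of the problem and `a ∈ ℝ^N` is such that
`aᵀx ≤ 0` implies `aᵀ(Px) ≥ 0`, then the cut `aᵀx ≥ 0` is valid: the supremum of
`xᵀAx` over `D` equals the supremum over `D ∩ {x : aᵀx ≥ 0}`. -/
theorem symmetry_breaking_cut_is_valid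
    (N M : ℕ)
    (A : Matrix (Fin N) (Fin N) ℝ) (B : Fin M → Matrix (Fin N) (Fin N) ℝ)
    (hA : A.IsSymm) (hB : ∀ i, (B i).IsSymm)
    (D : Set (Fin N → ℝ))
    (hD : D = {x | ∀ i, x ⬝ᵥ (B i).mulVec x ≤ 1})
    (P : Matrix (Fin N) (Fin N) ℝ) (hP : IsUnit P)
    (hPA : Pᵀ * A * P = A)
    (σ : Equiv.Perm (Fin M))
    (hPB : ∀ i, Pᵀ * B i * P = B (σ i))
    (a : Fin N → ℝ)
    (ha : ∀ x : Fin N → ℝ, a ⬝ᵥ x ≤ 0 → 0 ≤ a ⬝ᵥ P.mulVec x) :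
    sSup ((fun x => x ⬝ᵥ A.mulVec x) '' D) =
      sSup ((fun x => x ⬝ᵥ A.mulVec x) '' (D ∩ {x | 0 ≤ a ⬝ᵥ x})) := by
  congr 1
  refine (Set.image_mono Set.inter_subset_left).antisymm' ?_
  rintro _ ⟨x, hx, rfl⟩
  rcases le_total 0 (a ⬝ᵥ x) with h | h
  · exact ⟨x, ⟨hx, h⟩, rfl⟩
  · refine ⟨P.mulVec x, ⟨?_, ha x h⟩, ?_⟩
    · subst hD
      intro i
      rw [mulVec_dotProduct_mulVec_mulVec, hPB]
      exact hx (σ i)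
    · simp only [mulVec_dotProduct_mulVec_mulVec, hPA]
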